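/- arXiv:math/0504456 — 2 statements merged into one kernel-verified Lean document; each statement's English description precedes it below -/
import Mathlib

section
/- For every c ∈ ℂ with c ≠ 0 and all m, k ∈ ℤ, the identity (-c)^{m+k}·₁φ₁(-c q^{-m}; 0; q, q^{1+m+k}) = q^{m(m+k)}·₁φ₁(-c q^{-m}; 0; q, q^{1-m-k}) holds. (For m + k ≥ 0 the identity also holds for c = 0.) -/
open Finset

/-- The q-Pochhammer symbol `(a;q)_n = ∏_{j=0}^{n-1} (1 - a q^j)`. -/
noncomputable def qPoch (q a : ℂ) (n : ℕ) : ℂ :=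
  ∏ j ∈ Finset.range n, (1 - a * q ^ j)

/-- The basic hypergeometric series `₁φ₁(a; 0; q, y)`. -/
noncomputable def onePhiOne (q a y : ℂ) : ℂ :=
  ∑' n : ℕ, (qPoch q a n / qPoch q q n) * (-1) ^ n * q ^ (n * (n - 1) / 2) * y ^ n

/-- The coefficient of `y ^ n` in `₁φ₁(a; 0; q, y)`. -/
noncomputable def onePhiOneCoeff (q a : ℂ) (n : ℕ) : ℂ :=
  (qPoch q a n / qPoch q q n) * (-1) ^ n * q ^ (n * (n - 1) / 2)

theorem one_sub_pow_succ_ne_zero {q : ℂ} (hq : ‖q‖ < 1) (n : ℕ) : 1 - q ^ (n + 1) ≠ 0 := by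
  intro h
  have h1 : ‖q ^ (n + 1)‖ < 1 := by
    rw [norm_pow]
    exact pow_lt_one₀ (norm_nonneg q) hq n.succ_ne_zero
  rw [← sub_eq_zero.mp h, norm_one] at h1
  exact lt_irrefl _ h1

theorem qPoch_self_ne_zero {q : ℂ} (hq : ‖q‖ < 1) (n : ℕ) : qPoch q q n ≠ 0 := by
  refine Finset.prod_ne_zero_iff.mpr fun j _ => ?_
  rw [← pow_succ']
  exact one_sub_pow_succ_ne_zero hq j

theorem onePhiOneCoeff_succ {q : ℂ} (hq : ‖q‖ < 1) (a : ℂ) (n : ℕ) :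
    onePhiOneCoeff q a (n + 1) * (1 - q ^ (n + 1)) =
      -((1 - a * q ^ n) * q ^ n * onePhiOneCoeff q a n) := by
  have he : (n + 1) * (n + 1 - 1) / 2 = n * (n - 1) / 2 + n := by
    rw [← Finset.sum_range_id, ← Finset.sum_range_id, Finset.sum_range_succ]
  have h1 := one_sub_pow_succ_ne_zero hq n
  have h2 := qPoch_self_ne_zero hq n
  have ha : ∀ b : ℂ, qPoch q b (n + 1) = qPoch q b n * (1 - b * q ^ n) := fun b =>
    Finset.prod_range_succ _ _
  unfold onePhiOneCoeff
  rw [he, ha, ha, ← pow_succ' q n, pow_add q _ n, pow_succ (-1 : ℂ)]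
  generalize q ^ (n + 1) = Q at *
  field_simp

open Filter Topology in
theorem summable_onePhiOneCoeff {q : ℂ} (hq : ‖q‖ < 1) (a y : ℂ) :
    Summable fun n => onePhiOneCoeff q a n * y ^ n := by
  have hlim : Tendsto (fun n : ℕ => ‖(1 - a * q ^ n) * q ^ n * y / (1 - q ^ (n + 1))‖)
      atTop (𝓝 0) := by
    have hp := tendsto_pow_atTop_nhds_zero_of_norm_lt_one hq
    have hp1 := (tendsto_add_atTop_iff_nat 1).mpr hp
    have h := ((((hp.const_mul a).const_sub 1).mul hp).mul_const y).div (hp1.const_sub 1)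
      (by simp)
    simpa using h.norm
  refine summable_of_ratio_norm_eventually_le (r := 1 / 2) (by norm_num) ?_
  filter_upwards [hlim.eventually_le_const (show (0 : ℝ) < 1 / 2 by norm_num)] with n hn
  have h1 := one_sub_pow_succ_ne_zero hq n
  have hs : onePhiOneCoeff q a (n + 1) * y ^ (n + 1) =
      -((1 - a * q ^ n) * q ^ n * y / (1 - q ^ (n + 1))) * (onePhiOneCoeff q a n * y ^ n) := by
    rw [eq_div_of_mul_eq h1 (onePhiOneCoeff_succ hq a n)]
    ring
  rw [hs, norm_mul, norm_neg]
  gcongr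

theorem hasSum_onePhiOne {q : ℂ} (hq : ‖q‖ < 1) (a y : ℂ) :
    HasSum (fun n => onePhiOneCoeff q a n * y ^ n) (onePhiOne q a y) :=
  (summable_onePhiOneCoeff hq a y).hasSum

/-- The second-order `q`-difference equation of `₁φ₁(a; 0; q, ·)`. -/
theorem onePhiOne_sub {q : ℂ} (hq : ‖q‖ < 1) (a y : ℂ) :
    onePhiOne q a y - onePhiOne q a (q * y) =
      -y * (onePhiOne q a (q * y) - a * onePhiOne q a (q * (q * y))) := by
  have hL := (hasSum_onePhiOne hq a y).sub (hasSum_onePhiOne hq a (q * y))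
  have hR := ((hasSum_onePhiOne hq a (q * y)).sub
    ((hasSum_onePhiOne hq a (q * (q * y))).mul_left a)).mul_left (-y)
  rw [← hasSum_nat_add_iff' 1] at hL
  simp only [Finset.sum_range_one, pow_zero, sub_self, sub_zero] at hL
  refine hL.unique (hR.congr_fun ?_)
  intro n
  have h := onePhiOneCoeff_succ hq a n
  simp only [mul_pow]
  linear_combination y ^ (n + 1) * h

theorem onePhiOne_zpow_recurrence {q : ℂ} (hq0 : q ≠ 0) (hq : ‖q‖ < 1) (a : ℂ) (n : ℤ) :
    onePhiOne q a (q ^ n) =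
      (1 - q ^ n) * onePhiOne q a (q ^ (1 + n)) + a * q ^ n * onePhiOne q a (q ^ (1 + (1 + n))) := by
  have h := onePhiOne_sub hq a (q ^ n)
  simp only [← zpow_one_add₀ hq0] at h
  linear_combination h

theorem onePhiOne_zpow_one_sub_nat {q : ℂ} (hq0 : q ≠ 0) (hq : ‖q‖ < 1) (a : ℂ) (n : ℕ) :
    onePhiOne q a (q ^ (1 - n : ℤ)) = a ^ n * onePhiOne q a (q ^ (1 + n : ℤ)) := by
  induction n using Nat.twoStepInduction with
  | zero => simp
  | one => simpa using onePhiOne_zpow_recurrence hq0 hq a 0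
  | more n ih0 ih1 =>
    have hl := onePhiOne_zpow_recurrence hq0 hq a (-(n + 1))
    have hr := onePhiOne_zpow_recurrence hq0 hq a (n + 1)
    have hinv : q ^ (-(n + 1) : ℤ) * q ^ (n + 1 : ℤ) = 1 := by
      rw [← zpow_add₀ hq0, neg_add_cancel, zpow_zero]
    push_cast at ih1 ⊢
    rw [show (1 + (1 + -(n + 1)) : ℤ) = 1 - n by ring, ih0,
      show (1 + -(n + 1) : ℤ) = 1 - (n + 1) by ring, ih1,
      show (1 + n : ℤ) = n + 1 by ring, hr] at hl
    rw [show (1 - (n + 2) : ℤ) = -(n + 1) by ring, hl,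
      show (1 + (n + 2) : ℤ) = 1 + (1 + (n + 1)) by ring]
    linear_combination (a ^ (n + 1) * (a * onePhiOne q a (q ^ (1 + (1 + (n + 1)) : ℤ))
      - onePhiOne q a (q ^ (1 + (n + 1) : ℤ)))) * hinv

theorem onePhiOne_zpow_one_sub {q : ℂ} (hq0 : q ≠ 0) (hq : ‖q‖ < 1) (a : ℂ) (n : ℤ)
    (h : a ≠ 0 ∨ 0 ≤ n) :
    onePhiOne q a (q ^ (1 - n)) = a ^ n * onePhiOne q a (q ^ (1 + n)) := by
  obtain ⟨N, rfl | rfl⟩ := n.eq_nat_or_neg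
  · simpa using onePhiOne_zpow_one_sub_nat hq0 hq a N
  · rcases eq_or_ne a 0 with rfl | ha
    · obtain rfl : N = 0 := by simp at h; omega
      simp
    · have hN := onePhiOne_zpow_one_sub_nat hq0 hq a N
      rw [← sub_eq_add_neg, hN, sub_neg_eq_add, zpow_neg, zpow_natCast,
        inv_mul_cancel_left₀ (pow_ne_zero N ha)]

/-- for `0 < q < 1`, all `m, k ∈ ℤ` and `c ∈ ℂ` with `c ≠ 0` (or `c`
arbitrary when `m + k ≥ 0`),
`(-c)^{m+k} ₁φ₁(-c q^{-m}; 0; q, q^{1+m+k}) = q^{m(m+k)} ₁φ₁(-c q^{-m}; 0; q, q^{1-m-k})`. -/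
theorem onePhiOne_proportionality (q : ℝ) (hq0 : 0 < q) (hq1 : q < 1)
    (c : ℂ) (m k : ℤ) (hc : c ≠ 0 ∨ 0 ≤ m + k) :
    (-c) ^ (m + k) * onePhiOne q (-c * (q : ℂ) ^ (-m)) ((q : ℂ) ^ (1 + m + k)) =
      (q : ℂ) ^ (m * (m + k)) * onePhiOne q (-c * (q : ℂ) ^ (-m)) ((q : ℂ) ^ (1 - m - k)) := by
  have hq : (q : ℂ) ≠ 0 := Complex.ofReal_ne_zero.mpr hq0.ne'
  have hn : ‖(q : ℂ)‖ < 1 := by rwa [Complex.norm_real, Real.norm_of_nonneg hq0.le]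
  have h := onePhiOne_zpow_one_sub hq hn (-c * (q : ℂ) ^ (-m)) (m + k)
    (hc.imp_left fun hc => mul_ne_zero (neg_ne_zero.mpr hc) (zpow_ne_zero _ hq))
  have hm : (q : ℂ) ^ (m * (m + k)) * (q : ℂ) ^ (-m * (m + k)) = 1 := by
    rw [← zpow_add₀ hq, neg_mul, add_neg_cancel, zpow_zero]
  rw [add_assoc, sub_sub, h, mul_zpow, ← zpow_mul]
  linear_combination -((-c) ^ (m + k) *
    onePhiOne q (-c * (q : ℂ) ^ (-m)) ((q : ℂ) ^ (1 + (m + k)))) * hm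
end

section
/- Fix t > 0. For all r, s ∈ ℤ the doubly infinite sum Σ_{k∈ℤ} t^k·q^{k(k+1)/2}·M_r^{(t)}(t q^k;q)·M_s^{(t)}(t q^k;q) converges absolutely and equals δ_{r,s}·(-t;q)_∞·(-q/t;q)_r·q^{-r}, where for r ∈ ℤ the symbol (a;q)_r is defined by (a;q)_r = (a;q)_∞/(a q^r;q)_∞. (This is the Hansen–Lommel orthogonality relation for Jackson's second q-Bessel function.) -/
open Finset

/-- The real q-Pochhammer symbol `(a;q)_n = ∏_{j=0}^{n-1} (1 - a q^j)`. -/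
noncomputable def qPochR (q a : ℝ) (n : ℕ) : ℝ :=
  ∏ j ∈ Finset.range n, (1 - a * q ^ j)

/-- The infinite q-Pochhammer symbol `(a;q)_∞ = ∏_{j=0}^∞ (1 - a q^j)`. -/
noncomputable def qPochInfR (q a : ℝ) : ℝ :=
  ∏' j : ℕ, (1 - a * q ^ j)

/-- The q-Pochhammer symbol with integer index, `(a;q)_r = (a;q)_∞/(a q^r;q)_∞`. -/
noncomputable def qPochZ (q a : ℝ) (r : ℤ) : ℝ :=
  qPochInfR q a / qPochInfR q (a * q ^ r)

/-- `φ_z(x) = Σ_{n=0}^∞ (∏_{j=0}^{n-1} (z - q^j)) q^{n(n+1)/2} x^n/(q;q)_n`. -/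
noncomputable def phiSWR (q z x : ℝ) : ℝ :=
  ∑' n : ℕ, (∏ j ∈ Finset.range n, (z - q ^ j)) * q ^ (n * (n + 1) / 2) * x ^ n / qPochR q q n

/-- The q-Bessel function `M_r^{(t)}(x;q) = φ_{-q^r/t}(x)/(q;q)_∞`. -/
noncomputable def qBesselM (q t : ℝ) (r : ℤ) (x : ℝ) : ℝ :=
  phiSWR q (-q ^ r / t) x / qPochInfR q q

open Filter Topology

section QPochhammer

variable {q : ℝ}

lemma summable_norm_mul_pow (hq0 : 0 < q) (hq1 : q < 1) (a : ℝ) :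
    Summable fun j : ℕ => ‖-(a * q ^ j)‖ := by
  simp only [norm_neg, norm_mul, norm_pow]
  refine (summable_geometric_of_lt_one (norm_nonneg q) ?_).mul_left _
  rwa [Real.norm_of_nonneg hq0.le]

lemma multipliable_qPochInfR (hq0 : 0 < q) (hq1 : q < 1) (a : ℝ) :
    Multipliable fun j : ℕ => 1 - a * q ^ j := by
  simpa only [sub_eq_add_neg] using
    multipliable_one_add_of_summable (summable_norm_mul_pow hq0 hq1 a)

lemma qPochInfR_ne_zero (hq0 : 0 < q) (hq1 : q < 1) {a : ℝ} (ha : ∀ j : ℕ, a * q ^ j ≠ 1) :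
    qPochInfR q a ≠ 0 := by
  have := tprod_one_add_ne_zero_of_summable (f := fun j : ℕ => -(a * q ^ j))
    (fun j => by rw [← sub_eq_add_neg]; exact sub_ne_zero.2 (ha j).symm)
    (summable_norm_mul_pow hq0 hq1 a)
  unfold qPochInfR
  simpa only [← sub_eq_add_neg] using this

lemma qPochInfR_ne_zero_of_nonpos (hq0 : 0 < q) (hq1 : q < 1) {a : ℝ} (ha : a ≤ 0) :
    qPochInfR q a ≠ 0 :=
  qPochInfR_ne_zero hq0 hq1 fun j => by
    have := mul_nonpos_of_nonpos_of_nonneg ha (pow_pos hq0 j).le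
    linarith

lemma qPochR_mul_qPochInfR (hq0 : 0 < q) (hq1 : q < 1) (a : ℝ) (n : ℕ) :
    qPochR q a n * qPochInfR q (a * q ^ n) = qPochInfR q a := by
  have h := multipliable_qPochInfR hq0 hq1 (a * q ^ n)
  have h2 : (fun j : ℕ => 1 - a * q ^ n * q ^ j) = fun j => 1 - a * q ^ (j + n) := by
    funext j; ring
  rw [h2] at h
  unfold qPochR qPochInfR
  rw [h2]
  exact h.prod_mul_tprod_nat_mul' (f := fun j => 1 - a * q ^ j)

lemma qPochInfR_eq_one_sub_mul (hq0 : 0 < q) (hq1 : q < 1) (a : ℝ) :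
    qPochInfR q a = (1 - a) * qPochInfR q (a * q) := by
  simpa [qPochR] using (qPochR_mul_qPochInfR hq0 hq1 a 1).symm

lemma qPochInfR_zpow_eq_zero (hq0 : 0 < q) {N : ℤ} (hN : N ≤ 0) :
    qPochInfR q (q ^ N) = 0 := by
  refine tprod_of_exists_eq_zero ⟨N.natAbs, ?_⟩
  rw [← zpow_natCast, ← zpow_add₀ hq0.ne', show N + (N.natAbs : ℤ) = 0 by omega]
  simp

lemma qPochR_succ (q a : ℝ) (n : ℕ) : qPochR q a (n + 1) = qPochR q a n * (1 - a * q ^ n) :=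
  Finset.prod_range_succ _ _

lemma one_sub_pow_succ_pos (hq0 : 0 < q) (hq1 : q < 1) (n : ℕ) : 0 < 1 - q * q ^ n := by
  rw [← pow_succ', sub_pos]
  exact pow_lt_one₀ hq0.le hq1 n.succ_ne_zero

lemma qPochR_self_pos (hq0 : 0 < q) (hq1 : q < 1) (n : ℕ) : 0 < qPochR q q n :=
  Finset.prod_pos fun j _ => one_sub_pow_succ_pos hq0 hq1 j

lemma qPochInfR_self_ne_zero (hq0 : 0 < q) (hq1 : q < 1) : qPochInfR q q ≠ 0 :=
  qPochInfR_ne_zero hq0 hq1 fun j => by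
    have := one_sub_pow_succ_pos hq0 hq1 j
    linarith

lemma qPochInfR_self_le (hq0 : 0 < q) (hq1 : q < 1) (n : ℕ) :
    qPochInfR q q ≤ qPochR q q n := by
  refine Antitone.le_of_tendsto (f := qPochR q q) (antitone_nat_of_succ_le fun k => ?_)
    (multipliable_qPochInfR hq0 hq1 q).tendsto_prod_tprod_nat n
  rw [qPochR_succ]
  refine mul_le_of_le_one_right (qPochR_self_pos hq0 hq1 k).le ?_
  have : 0 < q * q ^ k := by positivity
  linarith

lemma qPochInfR_self_pos (hq0 : 0 < q) (hq1 : q < 1) : 0 < qPochInfR q q := by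
  refine lt_of_le_of_ne ?_ (qPochInfR_self_ne_zero hq0 hq1).symm
  exact ge_of_tendsto' (multipliable_qPochInfR hq0 hq1 q).tendsto_prod_tprod_nat
    fun n => (qPochR_self_pos hq0 hq1 n).le

lemma inv_qPochR_self_le (hq0 : 0 < q) (hq1 : q < 1) (n : ℕ) :
    (qPochR q q n)⁻¹ ≤ (qPochInfR q q)⁻¹ :=
  inv_anti₀ (qPochInfR_self_pos hq0 hq1) (qPochInfR_self_le hq0 hq1 n)

/-- The reciprocal `1/(q;q)_n` extended by zero to negative integers `n`. -/
noncomputable def qFactInv (q : ℝ) (n : ℤ) : ℝ :=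
  if 0 ≤ n then (qPochR q q n.toNat)⁻¹ else 0

lemma qFactInv_natCast (q : ℝ) (n : ℕ) : qFactInv q n = (qPochR q q n)⁻¹ := by
  simp [qFactInv]

lemma qFactInv_of_neg (q : ℝ) {n : ℤ} (hn : n < 0) : qFactInv q n = 0 :=
  if_neg hn.not_ge

lemma qFactInv_nonneg (hq0 : 0 < q) (hq1 : q < 1) (n : ℤ) : 0 ≤ qFactInv q n := by
  unfold qFactInv
  split_ifs
  · exact (inv_pos.2 (qPochR_self_pos hq0 hq1 _)).le
  · exact le_rfl

lemma qFactInv_le (hq0 : 0 < q) (hq1 : q < 1) (n : ℤ) :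
    qFactInv q n ≤ (qPochInfR q q)⁻¹ := by
  unfold qFactInv
  split_ifs
  · exact inv_qPochR_self_le hq0 hq1 _
  · exact (inv_pos.2 (qPochInfR_self_pos hq0 hq1)).le

lemma qPochInfR_zpow_div (hq0 : 0 < q) (hq1 : q < 1) (n : ℤ) :
    qPochInfR q (q ^ (n + 1)) / qPochInfR q q = qFactInv q n := by
  rcases lt_or_ge n 0 with hn | hn
  · rw [qPochInfR_zpow_eq_zero hq0 (by omega), qFactInv_of_neg q hn, zero_div]
  · lift n to ℕ using hn
    rw [qFactInv_natCast, ← qPochR_mul_qPochInfR hq0 hq1 q n]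
    have h1 := (qPochR_self_pos hq0 hq1 n).ne'
    have h2 := qPochInfR_self_ne_zero hq0 hq1
    rw [← qPochR_mul_qPochInfR hq0 hq1 q n, ← pow_succ'] at h2
    rw [← pow_succ', ← zpow_natCast]
    rw [← zpow_natCast] at h2
    push_cast at h2 ⊢
    have h3 := right_ne_zero_of_mul h2
    field_simp

/-- The finite `q`-binomial theorem, in homogeneous form. -/
lemma sum_antidiagonal_qBinomial (hq0 : 0 < q) (hq1 : q < 1) (x y : ℝ) (n : ℕ) :
    ∑ p ∈ antidiagonal n, q ^ (p.1.choose 2) * x ^ p.1 * y ^ p.2 *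
        ((qPochR q q p.1)⁻¹ * (qPochR q q p.2)⁻¹) =
      (∏ j ∈ Finset.range n, (y + x * q ^ j)) * (qPochR q q n)⁻¹ := by
  induction n with
  | zero => simp [qPochR]
  | succ n ih =>
    have hn := (one_sub_pow_succ_pos hq0 hq1 n).ne'
    rw [Finset.prod_range_succ, qPochR_succ, mul_inv]
    rw [show ∀ a b c d : ℝ, a * b * (c * d) = (a * c) * b * d by intros; ring, ← ih,
      eq_mul_inv_iff_mul_eq₀ hn, ← pow_succ']
    have key : ∀ p ∈ antidiagonal (n + 1), q ^ (p.1.choose 2) * x ^ p.1 * y ^ p.2 *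
        ((qPochR q q p.1)⁻¹ * (qPochR q q p.2)⁻¹) * (1 - q ^ (n + 1)) =
        q ^ (p.1.choose 2) * x ^ p.1 * y ^ p.2 *
          ((qPochR q q p.1)⁻¹ * (qPochR q q p.2)⁻¹) * (1 - q ^ p.2) +
        q ^ (p.1.choose 2) * x ^ p.1 * y ^ p.2 *
          ((qPochR q q p.1)⁻¹ * (qPochR q q p.2)⁻¹) * (q ^ p.2 * (1 - q ^ p.1)) := by
      intro p hp
      rw [← mem_antidiagonal.1 hp, pow_add]
      ring
    rw [Finset.sum_mul, Finset.sum_congr rfl key, Finset.sum_add_distrib,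
      Finset.Nat.sum_antidiagonal_succ', Finset.Nat.sum_antidiagonal_succ, mul_add,
      Finset.sum_mul, Finset.sum_mul]
    simp only [pow_zero, sub_self, mul_zero, zero_add]
    congr 1
    · refine Finset.sum_congr rfl fun p _ => ?_
      have h := (one_sub_pow_succ_pos hq0 hq1 p.2).ne'
      rw [qPochR_succ, mul_inv, pow_succ' q p.2]
      field_simp
      ring
    · refine Finset.sum_congr rfl fun p hp => ?_
      have h := inv_mul_cancel₀ (one_sub_pow_succ_pos hq0 hq1 p.1).ne'
      rw [qPochR_succ, mul_inv, pow_succ' q p.1, ← mem_antidiagonal.1 hp,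
        Nat.choose_succ_succ' p.1 1, Nat.choose_one_right]
      linear_combination q ^ p.1.choose 2 * x ^ p.1 * y ^ p.2 *
        ((qPochR q q p.1)⁻¹ * (qPochR q q p.2)⁻¹) * (x * q ^ (p.1 + p.2)) * h

lemma summable_pow_mul_pow_choose (hq0 : 0 < q) (hq1 : q < 1) (a : ℝ) :
    Summable fun n : ℕ => a ^ n * q ^ (n.choose 2) := by
  refine summable_of_ratio_norm_eventually_le (r := 1 / 2) (by norm_num) ?_
  have h : Tendsto (fun n : ℕ => |a| * q ^ n) atTop (𝓝 (|a| * 0)) :=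
    (tendsto_pow_atTop_nhds_zero_of_lt_one hq0.le hq1).const_mul _
  rw [mul_zero] at h
  filter_upwards [h.eventually_le_const (show (0 : ℝ) < 1 / 2 by norm_num)] with n hn
  rw [Nat.choose_succ_succ' n 1, Nat.choose_one_right, pow_succ, pow_add]
  calc ‖a ^ n * a * (q ^ n * q ^ n.choose 2)‖ = (|a| * q ^ n) * ‖a ^ n * q ^ n.choose 2‖ := by
        simp only [norm_mul, norm_pow, Real.norm_eq_abs, abs_of_pos hq0]
        ring
    _ ≤ _ := by gcongr

lemma summable_euler (hq0 : 0 < q) (hq1 : q < 1) (a : ℝ) :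
    Summable fun n : ℕ => a ^ n * q ^ (n.choose 2) * (qPochR q q n)⁻¹ := by
  refine Summable.of_norm_bounded
    ((summable_pow_mul_pow_choose hq0 hq1 |a|).mul_right (qPochInfR q q)⁻¹) fun n => ?_
  rw [norm_mul, Real.norm_of_nonneg (inv_pos.2 (qPochR_self_pos hq0 hq1 n)).le, norm_mul,
    norm_pow, norm_pow, Real.norm_eq_abs, Real.norm_of_nonneg hq0.le]
  gcongr
  · exact qPochInfR_self_pos hq0 hq1
  · exact qPochInfR_self_le hq0 hq1 n

lemma tsum_euler_step (hq0 : 0 < q) (hq1 : q < 1) (a : ℝ) :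
    ∑' n : ℕ, a ^ n * q ^ (n.choose 2) * (qPochR q q n)⁻¹ =
      (1 + a) * ∑' n : ℕ, (a * q) ^ n * q ^ (n.choose 2) * (qPochR q q n)⁻¹ := by
  have h1 := summable_euler hq0 hq1 a
  have h2 := summable_euler hq0 hq1 (a * q)
  have h : ∑' n : ℕ, (a ^ n * q ^ (n.choose 2) * (qPochR q q n)⁻¹ -
      (a * q) ^ n * q ^ (n.choose 2) * (qPochR q q n)⁻¹) =
      a * ∑' n : ℕ, (a * q) ^ n * q ^ (n.choose 2) * (qPochR q q n)⁻¹ := by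
    rw [(h1.sub h2).tsum_eq_zero_add, ← tsum_mul_left]
    simp only [pow_zero, sub_self, zero_add]
    refine tsum_congr fun n => ?_
    have h := (one_sub_pow_succ_pos hq0 hq1 n).ne'
    rw [qPochR_succ, mul_inv, Nat.choose_succ_succ' n 1, Nat.choose_one_right, pow_add, mul_pow,
      mul_pow]
    field_simp
    ring
  rw [h1.tsum_sub h2] at h
  linarith

/-- Euler's expansion of `(-a;q)_∞`. -/
lemma tsum_euler (hq0 : 0 < q) (hq1 : q < 1) (a : ℝ) :
    ∑' n : ℕ, a ^ n * q ^ (n.choose 2) * (qPochR q q n)⁻¹ = qPochInfR q (-a) := by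
  set F : ℝ → ℝ := fun a => ∑' n : ℕ, a ^ n * q ^ (n.choose 2) * (qPochR q q n)⁻¹ with hF
  have hiter : ∀ N : ℕ, F a = qPochR q (-a) N * F (a * q ^ N) := by
    intro N
    induction N with
    | zero => simp [qPochR]
    | succ N ih =>
      rw [ih, qPochR_succ, show F (a * q ^ N) = _ from tsum_euler_step hq0 hq1 (a * q ^ N),
        mul_assoc a, ← pow_succ]
      ring
  have hlim : Tendsto (fun N : ℕ => F (a * q ^ N)) atTop (𝓝 (F 0)) := by
    refine tendsto_tsum_of_dominated_convergence (summable_euler hq0 hq1 |a|) (fun n => ?_)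
      (Eventually.of_forall fun N n => ?_)
    · have h : Tendsto (fun N : ℕ => a * q ^ N) atTop (𝓝 (a * 0)) :=
        (tendsto_pow_atTop_nhds_zero_of_lt_one hq0.le hq1).const_mul _
      rw [mul_zero] at h
      exact ((h.pow n).mul_const _).mul_const _
    · have hN : q ^ N ≤ 1 := pow_le_one₀ hq0.le hq1.le
      have := inv_pos.2 (qPochR_self_pos hq0 hq1 n)
      rw [norm_mul, norm_mul, norm_pow, norm_mul, Real.norm_of_nonneg this.le,
        Real.norm_eq_abs, Real.norm_of_nonneg (pow_pos hq0 N).le,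
        Real.norm_of_nonneg (pow_pos hq0 _).le]
      gcongr
      exact mul_le_of_le_one_right (abs_nonneg a) hN
  have hF0 : F 0 = 1 := by
    rw [hF]
    simp only
    rw [tsum_eq_single 0 fun n hn => by simp [hn]]
    simp [qPochR]
  have h1 := (multipliable_qPochInfR hq0 hq1 (-a)).tendsto_prod_tprod_nat.mul hlim
  rw [hF0, mul_one] at h1
  refine tendsto_nhds_unique (tendsto_const_nhds (x := F a)) (h1.congr fun N => (hiter N).symm)

end QPochhammer

section DoubleSeries

lemma two_mul_ediv_mul_succ (k : ℤ) : 2 * (k * (k + 1) / 2) = k * (k + 1) :=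
  Int.mul_ediv_cancel' (Int.even_mul_succ_self k).two_dvd

lemma two_mul_cast_choose_two (n : ℕ) : 2 * ((n.choose 2 : ℕ) : ℤ) = n * (n - 1) := by
  induction n with
  | zero => simp
  | succ n ih =>
    rw [Nat.choose_succ_succ' n 1, Nat.choose_one_right]
    push_cast
    linear_combination ih

lemma tsum_sum_antidiagonal {f : ℕ × ℕ → ℝ} (hf : Summable f) :
    ∑' n, ∑ p ∈ antidiagonal n, f p = ∑' p, f p := by
  have hs : Summable fun x : Σ n : ℕ, antidiagonal n => f (x.2 : ℕ × ℕ) :=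
    Finset.HasAntidiagonal.sigmaAntidiagonalEquivProd.summable_iff.2 hf
  conv_lhs => congr; ext; rw [← Finset.sum_finset_coe, ← tsum_fintype (L := .unconditional _)]
  rw [← Finset.HasAntidiagonal.sigmaAntidiagonalEquivProd.tsum_eq]
  exact (hs.tsum_sigma' fun n => (hasSum_fintype _).summable).symm

variable {q : ℝ}

lemma prod_sub_mul_pow (z x q : ℝ) (n : ℕ) :
    (∏ j ∈ Finset.range n, (z - q ^ j)) * x ^ n =
      (-1) ^ n * ∏ j ∈ Finset.range n, (-(z * x) + x * q ^ j) := by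
  induction n with
  | zero => simp
  | succ n ih =>
    rw [Finset.prod_range_succ, Finset.prod_range_succ, pow_succ, pow_succ]
    linear_combination ((z - q ^ n) * x) * ih

/-- The double series obtained by expanding the products in `phiSWR`. -/
lemma summable_phiSWR_double (hq0 : 0 < q) (hq1 : q < 1) (x y : ℝ) :
    Summable fun p : ℕ × ℕ => (-1) ^ (p.1 + p.2) * q ^ ((p.1 + p.2 + 1).choose 2) *
      (q ^ (p.1.choose 2) * x ^ p.1 * y ^ p.2 * ((qPochR q q p.1)⁻¹ * (qPochR q q p.2)⁻¹)) := by
  have hp := fun n => (inv_pos.2 (qPochR_self_pos hq0 hq1 n)).le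
  have h := (summable_euler hq0 hq1 |x|).mul_of_nonneg (summable_euler hq0 hq1 |y|)
    (fun n => mul_nonneg (by positivity) (hp n)) (fun n => mul_nonneg (by positivity) (hp n))
  refine Summable.of_norm_bounded h fun p => ?_
  have hle : q ^ ((p.1 + p.2 + 1).choose 2) ≤ q ^ (p.2.choose 2) :=
    pow_le_pow_of_le_one hq0.le hq1.le (Nat.choose_le_choose 2 (by omega))
  have h1 := hp p.1
  have h2 := hp p.2
  simp only [norm_mul, norm_pow, norm_neg, norm_one, one_pow, one_mul, Real.norm_eq_abs,
    abs_of_pos hq0, abs_of_nonneg h1, abs_of_nonneg h2]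
  calc _ ≤ q ^ (p.2.choose 2) * (q ^ p.1.choose 2 * |x| ^ p.1 * |y| ^ p.2 *
          ((qPochR q q p.1)⁻¹ * (qPochR q q p.2)⁻¹)) := by gcongr
    _ = _ := by ring

lemma phiSWR_eq_tsum (hq0 : 0 < q) (hq1 : q < 1) (z x : ℝ) :
    phiSWR q z x = ∑' m : ℕ, (-1) ^ m * q ^ (m * m) * x ^ m * (qPochR q q m)⁻¹ *
      qPochInfR q (-(z * x) * q ^ (m + 1)) := by
  have hs := summable_phiSWR_double hq0 hq1 x (-(z * x))
  have h : phiSWR q z x = ∑' n, ∑ p ∈ antidiagonal n, (-1) ^ (p.1 + p.2) *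
      q ^ ((p.1 + p.2 + 1).choose 2) * (q ^ (p.1.choose 2) * x ^ p.1 * (-(z * x)) ^ p.2 *
        ((qPochR q q p.1)⁻¹ * (qPochR q q p.2)⁻¹)) := by
    refine tsum_congr fun n => ?_
    rw [Finset.sum_congr rfl (g := fun p => (-1) ^ n * q ^ ((n + 1).choose 2) *
      (q ^ (p.1.choose 2) * x ^ p.1 * (-(z * x)) ^ p.2 *
        ((qPochR q q p.1)⁻¹ * (qPochR q q p.2)⁻¹))) fun p hp => by rw [mem_antidiagonal.1 hp],
      ← Finset.mul_sum, sum_antidiagonal_qBinomial hq0 hq1, Nat.choose_two_right,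
      Nat.add_sub_cancel, mul_comm (n + 1) n, div_eq_mul_inv]
    linear_combination q ^ (n * (n + 1) / 2) * (qPochR q q n)⁻¹ * prod_sub_mul_pow z x q n
  rw [h, tsum_sum_antidiagonal hs, hs.tsum_prod]
  refine tsum_congr fun m => ?_
  rw [← neg_neg (-(z * x) * q ^ (m + 1)), ← tsum_euler hq0 hq1, ← tsum_mul_left]
  refine tsum_congr fun l => ?_
  have e : (m + l + 1).choose 2 + m.choose 2 = m * m + (m + 1) * l + l.choose 2 := by
    have h1 := two_mul_cast_choose_two (m + l + 1)
    have h2 := two_mul_cast_choose_two m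
    have h3 := two_mul_cast_choose_two l
    push_cast at h1
    zify
    have : (2 : ℤ) * (((m + l + 1).choose 2 : ℕ) + ((m.choose 2 : ℕ) : ℤ)) =
        2 * (m * m + (m + 1) * l + (l.choose 2 : ℕ)) := by
      linear_combination h1 + h2 - h3
    linarith
  have e' : q ^ ((m + l + 1).choose 2) * q ^ (m.choose 2) =
      q ^ (m * m) * (q ^ (m + 1)) ^ l * q ^ (l.choose 2) := by
    rw [← pow_add, e, pow_add, pow_add, pow_mul q (m + 1) l]
  generalize -(z * x) = y
  rw [neg_pow (y * q ^ (m + 1)), mul_pow]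
  linear_combination (-1) ^ (m + l) * x ^ m * y ^ l * ((qPochR q q m)⁻¹ * (qPochR q q l)⁻¹) * e'

/-- The terms of the expansion of `qBesselM q t r (t * q ^ k)` in powers of `t`. -/
noncomputable def qBesselTerm (q t : ℝ) (r k : ℤ) (m : ℕ) : ℝ :=
  (-1) ^ m * q ^ ((m : ℤ) * m + m * k) * t ^ m * (qPochR q q m)⁻¹ * qFactInv q (k + r + m)

lemma qBesselM_eq_tsum (hq0 : 0 < q) (hq1 : q < 1) {t : ℝ} (ht : 0 < t) (r k : ℤ) :
    qBesselM q t r (t * q ^ k) = ∑' m : ℕ, qBesselTerm q t r k m := by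
  have hq := hq0.ne'
  unfold qBesselM
  rw [phiSWR_eq_tsum hq0 hq1, div_eq_mul_inv, ← tsum_mul_right]
  refine tsum_congr fun m => ?_
  rw [qBesselTerm, ← qPochInfR_zpow_div hq0 hq1]
  have e : -(-q ^ r / t * (t * q ^ k)) * q ^ (m + 1) = q ^ (k + r + m + 1) := by
    rw [add_assoc (k + r), zpow_add₀ hq, zpow_add₀ hq]
    have : q ^ ((m : ℤ) + 1) = q ^ (m + 1) := by exact_mod_cast zpow_natCast q (m + 1)
    rw [this]
    field_simp
  have e2 : q ^ ((m : ℤ) * m + m * k) = q ^ (m * m) * (q ^ k) ^ m := by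
    rw [zpow_add₀ hq, mul_comm (m : ℤ) k, zpow_mul q k, zpow_natCast, ← Nat.cast_mul, zpow_natCast]
  rw [e, e2, mul_pow]
  ring

lemma summable_zpow_mul_zpow_triangle (hq0 : 0 < q) (hq1 : q < 1) (a : ℝ) :
    Summable fun k : ℤ => a ^ k * q ^ (k * (k + 1) / 2) := by
  refine Summable.of_nat_of_neg ?_ ?_
  · refine (summable_pow_mul_pow_choose hq0 hq1 (a * q)).congr fun n => ?_
    have e : (n : ℤ) * (n + 1) / 2 = n + (n.choose 2 : ℕ) := by
      have h1 := two_mul_ediv_mul_succ n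
      have h2 := two_mul_cast_choose_two n
      linarith
    rw [e, zpow_add₀ hq0.ne', mul_pow]
    simp only [zpow_natCast]
    ring
  · refine (summable_pow_mul_pow_choose hq0 hq1 a⁻¹).congr fun n => ?_
    have e : (-n : ℤ) * (-n + 1) / 2 = (n.choose 2 : ℕ) := by
      have h1 := two_mul_ediv_mul_succ (-n)
      have h2 := two_mul_cast_choose_two n
      linarith
    rw [e, zpow_neg, inv_pow]
    simp only [zpow_natCast]

lemma summable_zpow_mul_zpow_triangle_abs (hq0 : 0 < q) (hq1 : q < 1) {a b : ℝ} (ha : 0 < a)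
    (hb : 0 < b) : Summable fun k : ℤ => a ^ k * q ^ (k * (k + 1) / 2) * b ^ |k| := by
  refine Summable.of_nonneg_of_le (fun k => by positivity) (fun k => ?_)
    ((summable_zpow_mul_zpow_triangle hq0 hq1 (a * b)).add
      (summable_zpow_mul_zpow_triangle hq0 hq1 (a * b⁻¹)))
  have h : b ^ |k| ≤ b ^ k + b⁻¹ ^ k := by
    have h1 : 0 < b ^ k := zpow_pos hb k
    have h2 : 0 < b⁻¹ ^ k := zpow_pos (inv_pos.2 hb) k
    rcases abs_choice k with h | h <;> rw [h]
    · linarith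
    · rw [zpow_neg, ← inv_zpow]
      linarith
  rw [mul_zpow, mul_zpow]
  calc _ ≤ a ^ k * q ^ (k * (k + 1) / 2) * (b ^ k + b⁻¹ ^ k) := by gcongr
    _ = _ := by ring

lemma summable_zpow_sq_mul_zpow (hq0 : 0 < q) (hq1 : q < 1) {a : ℝ} (ha : 0 < a) :
    Summable fun k : ℤ => q ^ (k * k) * a ^ k := by
  refine Summable.of_nonneg_of_le (fun k => by positivity) (fun k => ?_)
    (summable_zpow_mul_zpow_triangle hq0 hq1 a)
  rw [mul_comm]
  refine mul_le_mul_of_nonneg_left (zpow_le_zpow_right_of_le_one₀ hq0 hq1.le ?_) (by positivity)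
  have h := two_mul_ediv_mul_succ k
  have h2 : k ≤ k * k := by
    rcases lt_or_ge k 1 with h | h <;> nlinarith
  linarith

lemma abs_qBesselTerm_le (hq0 : 0 < q) (hq1 : q < 1) {t : ℝ} (ht : 0 < t) (r k : ℤ) (m : ℕ) :
    |qBesselTerm q t r k m| ≤ (qPochInfR q q)⁻¹ ^ 2 * ((1 + t) * q ^ (-|r|)) ^ |k| *
      (q ^ ((m : ℤ) * m) * t ^ (m : ℤ) + q ^ ((m + k) * (m + k)) * t ^ (m + k)) := by
  have hC := inv_pos.2 (qPochInfR_self_pos hq0 hq1)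
  have hm := (inv_pos.2 (qPochR_self_pos hq0 hq1 m))
  have hP := qFactInv_nonneg hq0 hq1 (k + r + m)
  have hq : 1 ≤ q ^ (-|r|) := one_le_zpow_of_nonpos₀ hq0 hq1.le (by simp)
  have hρ : 1 ≤ (1 + t) * q ^ (-|r|) := one_le_mul_of_one_le_of_one_le (by linarith) hq
  rcases lt_or_ge (k + r + m) 0 with hneg | hpos
  · rw [qBesselTerm, qFactInv_of_neg q hneg, mul_zero, abs_zero]
    positivity
  have habs : |qBesselTerm q t r k m| =
      (qPochR q q m)⁻¹ * qFactInv q (k + r + m) * (q ^ ((m : ℤ) * m + m * k) * t ^ (m : ℤ)) := by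
    rw [qBesselTerm, abs_mul, abs_mul, abs_mul, abs_mul, abs_pow, abs_neg, abs_one, one_pow,
      abs_of_pos hm, abs_of_nonneg hP, abs_of_pos (zpow_pos hq0 _), abs_of_pos (pow_pos ht _),
      zpow_natCast t m]
    ring
  have hmain : q ^ ((m : ℤ) * m + m * k) * t ^ (m : ℤ) ≤ ((1 + t) * q ^ (-|r|)) ^ |k| *
      (q ^ ((m : ℤ) * m) * t ^ (m : ℤ) + q ^ ((m + k) * (m + k)) * t ^ (m + k)) := by
    rcases le_or_gt 0 k with hk | hk
    · have h1 : q ^ ((m : ℤ) * m + m * k) ≤ q ^ ((m : ℤ) * m) :=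
        zpow_le_zpow_right_of_le_one₀ hq0 hq1.le (by have := mul_nonneg m.cast_nonneg hk; linarith)
      calc _ ≤ 1 * (q ^ ((m : ℤ) * m) * t ^ (m : ℤ) + 0) := by
            rw [one_mul, add_zero]; gcongr
        _ ≤ _ := by
            gcongr
            · exact one_le_zpow₀ hρ (abs_nonneg k)
            · positivity
    · have h1 : q ^ ((m : ℤ) * m + m * k) ≤ (q ^ (-|r|)) ^ |k| * q ^ ((m + k) * (m + k)) := by
        rw [← zpow_mul, ← zpow_add₀ hq0.ne']
        refine zpow_le_zpow_right_of_le_one₀ hq0 hq1.le ?_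
        rw [abs_of_neg hk]
        have := mul_nonneg (neg_nonneg.2 hk.le)
          (show 0 ≤ (m + k) + |r| by have := le_abs_self r; linarith)
        linarith
      have h2 : t ^ (m : ℤ) ≤ (1 + t) ^ |k| * t ^ (m + k) := by
        rw [show (m : ℤ) = |k| + (m + k) by rw [abs_of_neg hk]; ring, zpow_add₀ ht.ne']
        rw [show |k| + (m + k) + k = m + k by rw [abs_of_neg hk]; ring]
        gcongr
        · exact zpow_le_zpow_left₀ (abs_nonneg k) ht.le (by linarith)
      calc _ ≤ ((q ^ (-|r|)) ^ |k| * q ^ ((m + k) * (m + k))) * ((1 + t) ^ |k| * t ^ (m + k)) := by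
            gcongr
        _ = ((1 + t) * q ^ (-|r|)) ^ |k| * (0 + q ^ ((m + k) * (m + k)) * t ^ (m + k)) := by
            rw [mul_zpow]; ring
        _ ≤ _ := by gcongr; positivity
  rw [habs, mul_assoc ((qPochInfR q q)⁻¹ ^ 2), pow_two]
  have h1 := inv_qPochR_self_le hq0 hq1 m
  have h2 := qFactInv_le hq0 hq1 (k + r + m)
  exact mul_le_mul (mul_le_mul h1 h2 hP hC.le) hmain (by positivity) (by positivity)

lemma Summable.mul_shear {W g : ℤ → ℝ} (hW : Summable W) (hg : Summable g) (hW0 : 0 ≤ W)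
    (hg0 : 0 ≤ g) (a b : ℤ) :
    Summable fun x : ℤ × ℕ × ℕ => W x.1 * (g (x.2.1 + a * x.1) * g (x.2.2 + b * x.1)) := by
  have h := hW.mul_of_nonneg (hg.mul_of_nonneg hg hg0 hg0) hW0
    (fun x => mul_nonneg (hg0 x.1) (hg0 x.2))
  refine h.comp_injective
    (i := fun x : ℤ × ℕ × ℕ => (x.1, ((x.2.1 : ℤ) + a * x.1, (x.2.2 : ℤ) + b * x.1))) ?_
  rintro ⟨k, m, i⟩ ⟨k', m', i'⟩ h
  simp only [Prod.mk.injEq] at h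
  obtain ⟨rfl, h1, h2⟩ := h
  simp only [add_left_inj, Nat.cast_inj] at h1 h2
  rw [h1, h2]

/-- The terms of the triple series obtained by expanding both `q`-Bessel functions. -/
noncomputable def qBesselTripleTerm (q t : ℝ) (r s : ℤ) (x : ℤ × ℕ × ℕ) : ℝ :=
  t ^ x.1 * q ^ (x.1 * (x.1 + 1) / 2) * (qBesselTerm q t r x.1 x.2.1 * qBesselTerm q t s x.1 x.2.2)

lemma summable_qBesselTripleTerm (hq0 : 0 < q) (hq1 : q < 1) {t : ℝ} (ht : 0 < t) (r s : ℤ) :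
    Summable (qBesselTripleTerm q t r s) := by
  set C := (qPochInfR q q)⁻¹
  set ρ := (1 + t) * q ^ (-|r|)
  set σ := (1 + t) * q ^ (-|s|)
  set g : ℤ → ℝ := fun u => q ^ (u * u) * t ^ u with hg
  set W : ℤ → ℝ := fun k => t ^ k * q ^ (k * (k + 1) / 2) * (ρ * σ) ^ |k| with hW
  have hρ : 0 < ρ := by positivity
  have hσ : 0 < σ := by positivity
  have hgs : Summable g := summable_zpow_sq_mul_zpow hq0 hq1 ht
  have hWs : Summable W := summable_zpow_mul_zpow_triangle_abs hq0 hq1 ht (mul_pos hρ hσ)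
  have hg0 : 0 ≤ g := fun u => by simp only [hg, Pi.zero_apply]; positivity
  have hW0 : 0 ≤ W := fun u => by simp only [hW, Pi.zero_apply]; positivity
  have hS := fun a b : ℤ => hWs.mul_shear hgs hW0 hg0 a b
  refine Summable.of_norm_bounded
    (((((hS 0 0).add (hS 0 1)).add (hS 1 0)).add (hS 1 1)).mul_left (C ^ 2 * C ^ 2)) ?_
  rintro ⟨k, m, i⟩
  have h1 := abs_qBesselTerm_le hq0 hq1 ht r k m
  have h2 := abs_qBesselTerm_le hq0 hq1 ht s k i
  simp only [qBesselTripleTerm, Real.norm_eq_abs, zero_mul, add_zero, one_mul]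
  rw [abs_mul, abs_mul (qBesselTerm q t r k m), abs_of_pos (by positivity)]
  calc _ ≤ t ^ k * q ^ (k * (k + 1) / 2) * (C ^ 2 * ρ ^ |k| * (g m + g (m + k)) *
        (C ^ 2 * σ ^ |k| * (g i + g (i + k)))) :=
      mul_le_mul_of_nonneg_left (mul_le_mul h1 h2 (abs_nonneg _) ((abs_nonneg _).trans h1))
        (by positivity)
    _ = _ := by
      simp only [hW, mul_zpow]
      ring

end DoubleSeries

section Orthogonality

variable {q : ℝ}

lemma tsum_qFactInv_sub (hq0 : 0 < q) (hq1 : q < 1) (x : ℝ) (n : ℕ) :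
    ∑' m : ℕ, x ^ m * q ^ (m.choose 2) * (qPochR q q m)⁻¹ * qFactInv q ((n : ℤ) - m) =
      (∏ j ∈ Finset.range n, (1 + x * q ^ j)) * (qPochR q q n)⁻¹ := by
  rw [← sum_antidiagonal_qBinomial hq0 hq1, Finset.Nat.sum_antidiagonal_eq_sum_range_succ_mk,
    tsum_eq_sum (s := Finset.range n.succ)]
  · refine Finset.sum_congr rfl fun m hm => ?_
    rw [← Nat.cast_sub (Nat.lt_succ_iff.1 (Finset.mem_range.1 hm)), qFactInv_natCast, one_pow]
    ring
  · intro m hm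
    rw [Finset.mem_range, not_lt] at hm
    rw [qFactInv_of_neg q (by omega), mul_zero]

lemma prod_one_sub_zpow_neg (hq0 : 0 < q) (i : ℕ) :
    ∏ j ∈ Finset.range i, (1 + -q ^ (-(i : ℤ)) * q ^ j) =
      (-1) ^ i * q ^ (-(((i + 1).choose 2 : ℕ) : ℤ)) * qPochR q q i := by
  have hq := hq0.ne'
  have h : ∀ j ∈ Finset.range i, 1 + -q ^ (-(i : ℤ)) * q ^ j =
      1 - q ^ (-((i - 1 - j : ℕ) + 1 : ℤ)) := by
    intro j hj
    have hj := Finset.mem_range.1 hj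
    rw [neg_mul, ← zpow_natCast q j, ← zpow_add₀ hq, ← sub_eq_add_neg]
    congr 2
    omega
  rw [Finset.prod_congr rfl h, Finset.prod_range_reflect (fun j => 1 - q ^ (-((j : ℤ) + 1)))]
  clear h
  induction i with
  | zero => simp [qPochR]
  | succ i ih =>
    rw [Finset.prod_range_succ, ih, qPochR_succ, Nat.choose_succ_succ' (i + 1) 1,
      Nat.choose_one_right, pow_succ]
    have e : q ^ (-((i + 1 + (i + 1).choose 2 : ℕ) : ℤ)) =
        q ^ (-((i : ℤ) + 1)) * q ^ (-(((i + 1).choose 2 : ℕ) : ℤ)) := by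
      rw [← zpow_add₀ hq]
      congr 1
      push_cast
      ring
    have e2 : q ^ (-((i : ℤ) + 1)) * (q * q ^ i) = 1 := by
      rw [← pow_succ', ← zpow_natCast, ← zpow_add₀ hq]
      simp
    rw [e]
    linear_combination -(-1) ^ i * q ^ (-(((i + 1).choose 2 : ℕ) : ℤ)) * qPochR q q i * e2

/-- The shear `(j, (i, m)) ↦ (j - m, (m, i))` used to rearrange the triple series. -/
def shearEquiv : ℤ × ℕ × ℕ ≃ ℤ × ℕ × ℕ where
  toFun x := (x.1 - x.2.2, (x.2.2, x.2.1))
  invFun x := (x.1 + x.2.1, (x.2.2, x.2.1))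
  left_inv x := by simp
  right_inv x := by simp

lemma qBesselTripleTerm_shear (hq0 : 0 < q) {t : ℝ} (ht : 0 < t) (r s j : ℤ) (i m : ℕ) :
    qBesselTripleTerm q t r s (shearEquiv (j, (i, m))) =
      t ^ j * q ^ (j * (j + 1) / 2) * qFactInv q (j + r) *
        ((-1) ^ i * q ^ ((i : ℤ) * i + i * j) * t ^ i * (qPochR q q i)⁻¹) *
        ((-q ^ (-(i : ℤ))) ^ m * q ^ (m.choose 2) * (qPochR q q m)⁻¹ *
          qFactInv q (j + s + i - m)) := by
  have hq := hq0.ne'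
  have e : q ^ ((j - m) * (j - m + 1) / 2) * q ^ ((m : ℤ) * m + m * (j - m)) *
      q ^ ((i : ℤ) * i + i * (j - m)) = q ^ (j * (j + 1) / 2) * q ^ ((i : ℤ) * i + i * j) *
        ((q ^ (-(i : ℤ))) ^ m * q ^ (m.choose 2)) := by
    rw [← zpow_natCast (q ^ (-(i : ℤ))), ← zpow_natCast q (m.choose 2), ← zpow_mul]
    simp only [← zpow_add₀ hq]
    congr 1
    have h1 := two_mul_ediv_mul_succ (j - m)
    have h2 := two_mul_ediv_mul_succ j
    have h3 := two_mul_cast_choose_two m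
    have : ∀ a b : ℤ, 2 * a = 2 * b → a = b := fun a b h => by omega
    apply this
    linear_combination h1 - h2 - h3
  have et : t ^ (j - m) * t ^ m = t ^ j := by
    rw [← zpow_natCast t m, ← zpow_add₀ ht.ne', sub_add_cancel]
  simp only [qBesselTripleTerm, qBesselTerm, shearEquiv, Equiv.coe_fn_mk]
  rw [show j - m + r + m = j + r by ring, show j - m + s + i = j + s + i - m by ring, ← et,
    neg_pow (q ^ (-(i : ℤ)))]
  linear_combination t ^ (j - m) * t ^ m * qFactInv q (j + r) * (-1) ^ i * t ^ i *
    (qPochR q q i)⁻¹ * (-1) ^ m * (qPochR q q m)⁻¹ * qFactInv q (j + s + i - m) * e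

lemma tsum_qBesselTripleTerm_shear (hq0 : 0 < q) (hq1 : q < 1) {t : ℝ} (ht : 0 < t) {r s : ℤ}
    (hrs : r ≤ s) (j : ℤ) (i : ℕ) :
    ∑' m : ℕ, qBesselTripleTerm q t r s (shearEquiv (j, (i, m))) =
      if r = s ∧ j = -r then
        t ^ (-r) * q ^ (-r * (-r + 1) / 2) *
          ((t * q ^ (-r)) ^ i * q ^ (i.choose 2) * (qPochR q q i)⁻¹)
      else 0 := by
  have hq := hq0.ne'
  simp only [qBesselTripleTerm_shear hq0 ht, tsum_mul_left]
  rcases lt_or_ge (j + r) 0 with hneg | hpos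
  · rw [qFactInv_of_neg q hneg, if_neg (by omega)]
    simp
  obtain ⟨n, hn⟩ := Int.eq_ofNat_of_zero_le (show 0 ≤ j + s + i by omega)
  rw [hn, tsum_qFactInv_sub hq0 hq1]
  split_ifs with h
  · obtain ⟨rfl, rfl⟩ := h
    obtain rfl : n = i := by omega
    have hi := (qPochR_self_pos hq0 hq1 n).ne'
    have hP : qFactInv q (-r + r) = 1 := by
      rw [neg_add_cancel]
      simpa [qPochR] using qFactInv_natCast q 0
    have e : q ^ ((n : ℤ) * n + n * -r) * q ^ (-(((n + 1).choose 2 : ℕ) : ℤ)) =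
        (q ^ (-r)) ^ n * q ^ (n.choose 2) := by
      rw [← zpow_natCast (q ^ (-r)), ← zpow_natCast q (n.choose 2), ← zpow_mul, ← zpow_add₀ hq,
        ← zpow_add₀ hq, Nat.choose_succ_succ' n 1, Nat.choose_one_right]
      congr 1
      have h3 := two_mul_cast_choose_two n
      push_cast
      linear_combination -h3
    have e1 : ((-1 : ℝ) ^ n) * (-1) ^ n = 1 := by rw [← mul_pow]; simp
    rw [prod_one_sub_zpow_neg hq0, hP, mul_inv_cancel_right₀ hi, mul_pow]
    linear_combination t ^ (-r) * q ^ (-r * (-r + 1) / 2) * t ^ n * (qPochR q q n)⁻¹ * (e +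
      q ^ ((n : ℤ) * n + n * -r) * q ^ (-(((n + 1).choose 2 : ℕ) : ℤ)) * e1)
  · have hlt : i < n := by omega
    rw [Finset.prod_eq_zero (Finset.mem_range.2 hlt)]
    · simp
    · rw [neg_mul, ← zpow_natCast q i, ← zpow_add₀ hq]
      simp

lemma tsum_qBesselTripleTerm (hq0 : 0 < q) (hq1 : q < 1) {t : ℝ} (ht : 0 < t) {r s : ℤ}
    (hrs : r ≤ s) :
    ∑' x, qBesselTripleTerm q t r s x =
      if r = s then t ^ (-r) * q ^ (-r * (-r + 1) / 2) * qPochInfR q (-(t * q ^ (-r))) else 0 := by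
  have hs : Summable fun x => qBesselTripleTerm q t r s (shearEquiv x) :=
    shearEquiv.summable_iff.2 (summable_qBesselTripleTerm hq0 hq1 ht r s)
  rw [← shearEquiv.tsum_eq, hs.tsum_prod]
  have h : ∀ j : ℤ, ∑' p : ℕ × ℕ, qBesselTripleTerm q t r s (shearEquiv (j, p)) =
      if r = s ∧ j = -r then
        t ^ (-r) * q ^ (-r * (-r + 1) / 2) * qPochInfR q (-(t * q ^ (-r))) else 0 := by
    intro j
    rw [(hs.prod_factor j).tsum_prod]
    simp only [tsum_qBesselTripleTerm_shear hq0 hq1 ht hrs]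
    split_ifs
    · rw [tsum_mul_left, tsum_euler hq0 hq1]
    · exact tsum_zero
  rw [tsum_congr h]
  by_cases hrs' : r = s
  · simp only [hrs', true_and, if_true]
    exact tsum_ite_eq _ _
  · simp [hrs']

lemma zpow_mul_qPochInfR_eq (hq0 : 0 < q) (hq1 : q < 1) {t : ℝ} (ht : 0 < t) (r : ℤ) :
    t ^ (-r) * q ^ (-r * (-r + 1) / 2) * qPochInfR q (-(t * q ^ (-r))) =
      qPochInfR q (-t) * qPochZ q (-q / t) r * q ^ (-r) := by
  have hq := hq0.ne'
  have ht' := ht.ne'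
  set G : ℤ → ℝ := fun r => t ^ (-r) * q ^ (-r * (-r + 1) / 2 + r) *
    qPochInfR q (-(t * q ^ (-r))) * qPochInfR q (-q / t * q ^ r) with hG
  have hstep : ∀ r, G (r + 1) = G r := by
    intro r
    simp only [hG]
    have h1 := qPochInfR_eq_one_sub_mul hq0 hq1 (-(t * q ^ (-(r + 1))))
    have h2 := qPochInfR_eq_one_sub_mul hq0 hq1 (-q / t * q ^ r)
    have e1 : -(t * q ^ (-(r + 1))) * q = -(t * q ^ (-r)) := by
      rw [neg_add, zpow_add₀ hq, zpow_neg_one]; field_simp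
    have e2 : -q / t * q ^ r * q = -q / t * q ^ (r + 1) := by rw [zpow_add_one₀ hq]; ring
    have e3 : -(r + 1) * (-(r + 1) + 1) / 2 + (r + 1) = (-r * (-r + 1) / 2 + r) + (r + 1) := by
      have h3 := two_mul_ediv_mul_succ (-(r + 1))
      have h4 := two_mul_ediv_mul_succ (-r)
      have : ∀ a b : ℤ, 2 * a = 2 * b → a = b := fun a b h => by omega
      apply this
      linear_combination h3 - h4
    rw [h1, h2, e1, e2, e3, zpow_add₀ hq _ (r + 1), neg_add, zpow_add₀ ht', zpow_neg_one,
      zpow_add₀ hq (-r), zpow_neg_one, zpow_add_one₀ hq r, zpow_neg q r]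
    have : q ^ r ≠ 0 := (zpow_pos hq0 r).ne'
    field_simp
    ring
  have hconst : G r = G 0 := by
    induction r with
    | zero => rfl
    | succ n ih => rw [hstep, ih]
    | pred n ih => rw [← ih, ← hstep, sub_add_cancel]
  have hne : qPochInfR q (-q / t * q ^ r) ≠ 0 := by
    refine qPochInfR_ne_zero_of_nonpos hq0 hq1 ?_
    rw [neg_div, neg_mul]
    exact neg_nonpos.2 (by positivity)
  have hG0 : G 0 = qPochInfR q (-t) * qPochInfR q (-q / t) := by simp [hG]
  rw [hG0] at hconst
  simp only [hG] at hconst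
  rw [qPochZ, ← mul_div_assoc, ← hconst, zpow_add₀ hq]
  generalize qPochInfR q (-(t * q ^ (-r))) = A
  generalize qPochInfR q (-q / t * q ^ r) = B at hne ⊢
  rw [zpow_neg q r]
  have : q ^ r ≠ 0 := (zpow_pos hq0 r).ne'
  field_simp

lemma summable_norm_qBesselTerm (hq0 : 0 < q) (hq1 : q < 1) {t : ℝ} (ht : 0 < t) (r k : ℤ) :
    Summable fun m => ‖qBesselTerm q t r k m‖ := by
  have hg := summable_zpow_sq_mul_zpow hq0 hq1 ht
  have h1 := hg.comp_injective (i := fun m : ℕ => (m : ℤ)) Nat.cast_injective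
  have h2 := hg.comp_injective (i := fun m : ℕ => (m : ℤ) + k)
    ((add_left_injective k).comp Nat.cast_injective)
  exact Summable.of_nonneg_of_le (fun m => norm_nonneg _)
    (fun m => abs_qBesselTerm_le hq0 hq1 ht r k m) ((h1.add h2).mul_left _)

lemma hasSum_qBesselM_mul (hq0 : 0 < q) (hq1 : q < 1) {t : ℝ} (ht : 0 < t) (r s : ℤ) :
    HasSum (fun k : ℤ => t ^ k * q ^ (k * (k + 1) / 2) *
      qBesselM q t r (t * q ^ k) * qBesselM q t s (t * q ^ k))
      (∑' x, qBesselTripleTerm q t r s x) := by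
  have hs := summable_qBesselTripleTerm hq0 hq1 ht r s
  refine hs.hasSum.prod_fiberwise fun k => (hs.prod_factor k).hasSum_iff.2 ?_
  simp only [qBesselTripleTerm]
  rw [tsum_mul_left, ← tsum_mul_tsum_of_summable_norm (summable_norm_qBesselTerm hq0 hq1 ht r k)
    (summable_norm_qBesselTerm hq0 hq1 ht s k), qBesselM_eq_tsum hq0 hq1 ht,
    qBesselM_eq_tsum hq0 hq1 ht, ← mul_assoc]

lemma hasSum_qBesselM_mul_of_le (hq0 : 0 < q) (hq1 : q < 1) {t : ℝ} (ht : 0 < t) {r s : ℤ}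
    (hrs : r ≤ s) :
    HasSum (fun k : ℤ => t ^ k * q ^ (k * (k + 1) / 2) *
      qBesselM q t r (t * q ^ k) * qBesselM q t s (t * q ^ k))
      ((if r = s then 1 else 0) * qPochInfR q (-t) * qPochZ q (-q / t) r * q ^ (-r)) := by
  convert hasSum_qBesselM_mul hq0 hq1 ht r s using 1
  rw [tsum_qBesselTripleTerm hq0 hq1 ht hrs, zpow_mul_qPochInfR_eq hq0 hq1 ht]
  split_ifs <;> ring

end Orthogonality

/-- Hansen--Lommel orthogonality: for `0 < q < 1`, `t > 0` and `r, s ∈ ℤ`,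
the doubly infinite sum converges absolutely and
`Σ_{k∈ℤ} t^k q^{k(k+1)/2} M_r^{(t)}(t q^k;q) M_s^{(t)}(t q^k;q)
  = δ_{r,s} (-t;q)_∞ (-q/t;q)_r q^{-r}`. -/
theorem qBesselM_discrete_orthogonality (q : ℝ) (hq0 : 0 < q) (hq1 : q < 1)
    (t : ℝ) (ht : 0 < t) (r s : ℤ) :
    (Summable fun k : ℤ =>
      |t ^ k * q ^ (k * (k + 1) / 2) *
        qBesselM q t r (t * q ^ k) * qBesselM q t s (t * q ^ k)|) ∧
    ∑' k : ℤ, t ^ k * q ^ (k * (k + 1) / 2) *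
        qBesselM q t r (t * q ^ k) * qBesselM q t s (t * q ^ k) =
      (if r = s then 1 else 0) * qPochInfR q (-t) * qPochZ q (-q / t) r * q ^ (-r) := by
  have h : HasSum (fun k : ℤ => t ^ k * q ^ (k * (k + 1) / 2) *
      qBesselM q t r (t * q ^ k) * qBesselM q t s (t * q ^ k))
      ((if r = s then 1 else 0) * qPochInfR q (-t) * qPochZ q (-q / t) r * q ^ (-r)) := by
    rcases le_total r s with hrs | hrs
    · exact hasSum_qBesselM_mul_of_le hq0 hq1 ht hrs
    · convert hasSum_qBesselM_mul_of_le hq0 hq1 ht hrs using 1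
      · funext k
        ring
      · by_cases h : r = s
        · rw [h]
        · rw [if_neg h, if_neg (Ne.symm h)]
          ring
  exact ⟨h.summable.abs, h.tsum_eq⟩
end
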